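/- arXiv:1403.7271 — 3 statements merged into one kernel-verified Lean document; each statement's English description precedes it below -/
import Mathlib

section
/- The function l_m defined by l_m(r) = 2^{(d−1)/2} Γ((d+1)/2) / (m^{(d+1)/2} ∫_r^∞ u^{(d−3)/2} K_{(d+1)/2}(mu) du) is a strictly increasing smooth function on (0,∞) with l_m(r) → 0 as r → 0+ and l_m(r) → ∞ as r → ∞. -/
open Filter

/-- Modified Bessel function of the second kind (Macdonald function) of order `ν`. -/
noncomputable def besselK (ν τ : ℝ) : ℝ :=
  ∫ s in Set.Ioi (0 : ℝ), Real.exp (-τ * Real.cosh s) * Real.cosh (ν * s)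

/-- `l_m(r) = 2^{(d−1)/2} Γ((d+1)/2) / (m^{(d+1)/2} ∫_r^∞ u^{(d−3)/2} K_{(d+1)/2}(mu) du)`. -/
noncomputable def lm (d : ℕ) (m r : ℝ) : ℝ :=
  2 ^ (((d : ℝ) - 1) / 2) * Real.Gamma (((d : ℝ) + 1) / 2) /
    (m ^ (((d : ℝ) + 1) / 2) *
      ∫ u in Set.Ioi r, u ^ (((d : ℝ) - 3) / 2) * besselK (((d : ℝ) + 1) / 2) (m * u))

open MeasureTheory in
theorem integrableOn_exp_neg_mul_cosh_mul_cosh (ν : ℝ) {τ : ℝ} (hτ : 0 < τ) :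
    IntegrableOn (fun s ↦ Real.exp (-τ * Real.cosh s) * Real.cosh (ν * s)) (Set.Ioi 0) := by
  have hg : Integrable (fun s : ℝ ↦ Real.exp (2 * ν ^ 2 / τ) * Real.exp (-(τ / 8) * s ^ 2)) :=
    (integrable_exp_neg_mul_sq (by positivity)).const_mul _
  refine hg.integrableOn.mono' ?_ ?_
  · exact Continuous.aestronglyMeasurable (by fun_prop)
  refine (ae_restrict_mem measurableSet_Ioi).mono fun s (hs : 0 < s) ↦ ?_
  rw [Real.norm_of_nonneg (by positivity)]
  have h1 : s ^ 2 / 4 ≤ Real.cosh s := by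
    rw [Real.cosh_eq]
    linarith [Real.quadratic_le_exp_of_nonneg hs.le, Real.add_one_le_exp (-s)]
  have h2 : Real.cosh (ν * s) ≤ Real.exp |ν * s| := by
    rw [← Real.cosh_abs, Real.cosh_eq]
    linarith [Real.exp_le_exp.2 (neg_le_self (abs_nonneg (ν * s)))]
  have h3 : |ν * s| ≤ 2 * ν ^ 2 / τ + τ / 8 * s ^ 2 := by
    have h4 : 2 * ν ^ 2 / τ + τ / 8 * s ^ 2 - ν * s = 2 / τ * (ν - τ / 4 * s) ^ 2 := by
      field_simp
      ring
    have h5 : 2 * ν ^ 2 / τ + τ / 8 * s ^ 2 + ν * s = 2 / τ * (ν + τ / 4 * s) ^ 2 := by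
      field_simp
      ring
    have h6 : 0 ≤ 2 / τ * (ν - τ / 4 * s) ^ 2 := by positivity
    have h7 : 0 ≤ 2 / τ * (ν + τ / 4 * s) ^ 2 := by positivity
    exact abs_le.2 ⟨by linarith, by linarith⟩
  calc _ ≤ Real.exp (-τ * (s ^ 2 / 4)) * Real.exp |ν * s| := by
        refine mul_le_mul (Real.exp_le_exp.2 ?_) h2 (Real.cosh_pos _).le (Real.exp_pos _).le
        nlinarith
    _ ≤ _ := by
        rw [← Real.exp_add, ← Real.exp_add]
        refine Real.exp_le_exp.2 ?_
        linarith

theorem besselK_pos (ν : ℝ) {τ : ℝ} (hτ : 0 < τ) : 0 < besselK ν τ := by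
  refine (MeasureTheory.setIntegral_pos_iff_support_of_nonneg_ae
    (Eventually.of_forall fun s ↦ ?_) (integrableOn_exp_neg_mul_cosh_mul_cosh ν hτ)).2 ?_
  · exact mul_nonneg (Real.exp_pos _).le (Real.cosh_pos _).le
  · have h : (Function.support fun s ↦ Real.exp (-τ * Real.cosh s) * Real.cosh (ν * s))
        = Set.univ :=
      Set.eq_univ_of_forall fun s ↦ (mul_pos (Real.exp_pos _) (Real.cosh_pos _)).ne'
    rw [h]
    simp

theorem besselK_le_exp (ν : ℝ) {τ : ℝ} (hτ : 1 ≤ τ) :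
    besselK ν τ ≤ Real.exp (1 - τ) * besselK ν 1 := by
  unfold besselK
  rw [← MeasureTheory.integral_const_mul]
  refine MeasureTheory.setIntegral_mono
    (integrableOn_exp_neg_mul_cosh_mul_cosh ν (by linarith))
    ((integrableOn_exp_neg_mul_cosh_mul_cosh ν one_pos).const_mul _) fun s ↦ ?_
  dsimp only
  rw [← mul_assoc, ← Real.exp_add]
  refine mul_le_mul_of_nonneg_right (Real.exp_le_exp.2 ?_) (Real.cosh_pos _).le
  nlinarith [Real.one_le_cosh s]

/-- The lower bound matching the singularity of the Macdonald function at the origin. -/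
theorem rpow_neg_le_besselK {ν : ℝ} (hν : 0 ≤ ν) {τ : ℝ} (hτ : 0 < τ) (hτ1 : τ ≤ 1) :
    Real.exp (-Real.exp 1) / 2 * τ ^ (-ν) ≤ besselK ν τ := by
  have hL : 0 ≤ -Real.log τ := neg_nonneg.2 (Real.log_nonpos hτ.le hτ1)
  have hint := integrableOn_exp_neg_mul_cosh_mul_cosh ν hτ
  have hsub : Set.Ioc (-Real.log τ) (-Real.log τ + 1) ⊆ Set.Ioi 0 :=
    fun s hs ↦ hL.trans_lt hs.1
  have hbound : ∀ s ∈ Set.Ioc (-Real.log τ) (-Real.log τ + 1),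
      Real.exp (-Real.exp 1) / 2 * τ ^ (-ν)
        ≤ Real.exp (-τ * Real.cosh s) * Real.cosh (ν * s) := by
    intro s hs
    have hs0 : 0 < s := hsub hs
    have h1 : Real.cosh s ≤ Real.exp s := by
      rw [Real.cosh_eq]
      linarith [Real.exp_le_exp.2 (show -s ≤ s by linarith)]
    have h2 : τ * Real.cosh s ≤ Real.exp 1 := calc
      _ ≤ τ * Real.exp (-Real.log τ + 1) := by
        gcongr
        exact h1.trans (Real.exp_le_exp.2 hs.2)
      _ = _ := by
        rw [Real.exp_add, Real.exp_neg, Real.exp_log hτ, mul_inv_cancel_left₀ hτ.ne']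
    have h3 : τ ^ (-ν) / 2 ≤ Real.cosh (ν * s) := by
      rw [Real.rpow_def_of_pos hτ, Real.cosh_eq]
      have : Real.log τ * -ν ≤ ν * s := by nlinarith [hs.1]
      linarith [Real.exp_le_exp.2 this, Real.exp_pos (-(ν * s))]
    calc _ = Real.exp (-Real.exp 1) * (τ ^ (-ν) / 2) := by ring
      _ ≤ _ := by
        refine mul_le_mul (Real.exp_le_exp.2 ?_) h3 (by positivity) (Real.exp_pos _).le
        linarith
  calc _ = ∫ _ in Set.Ioc (-Real.log τ) (-Real.log τ + 1),
        Real.exp (-Real.exp 1) / 2 * τ ^ (-ν) := by simp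
    _ ≤ ∫ s in Set.Ioc (-Real.log τ) (-Real.log τ + 1),
        Real.exp (-τ * Real.cosh s) * Real.cosh (ν * s) :=
      MeasureTheory.setIntegral_mono_on (MeasureTheory.integrableOn_const (by simp))
        (hint.mono_set hsub) measurableSet_Ioc hbound
    _ ≤ _ := by
      refine MeasureTheory.setIntegral_mono_set hint (Eventually.of_forall fun s ↦ ?_)
        hsub.eventuallyLE
      exact mul_nonneg (Real.exp_pos _).le (Real.cosh_pos _).le

open MeasureTheory ProbabilityTheory in
/-- `besselK ν` is the reflected moment-generating function of `cosh` under the weight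
`cosh (ν s) ds` on the half-line, hence smooth. -/
theorem contDiffOn_besselK (ν : ℝ) : ContDiffOn ℝ (⊤ : ℕ∞) (besselK ν) (Set.Ioi 0) := by
  set μ : Measure ℝ := (volume.restrict (Set.Ioi 0)).withDensity
    fun s ↦ ENNReal.ofReal (Real.cosh (ν * s)) with hμ
  have hmeas : Measurable fun s ↦ ENNReal.ofReal (Real.cosh (ν * s)) := by fun_prop
  have hcosh (s : ℝ) : 0 ≤ Real.cosh (ν * s) := (Real.cosh_pos _).le
  have hmgf : besselK ν = fun τ ↦ mgf Real.cosh μ (-τ) := by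
    ext τ
    rw [mgf, hμ, integral_withDensity_eq_integral_toReal_smul hmeas (by simp)]
    simp [besselK, ENNReal.toReal_ofReal, hcosh, mul_comm]
  have hsub : Set.Iio 0 ⊆ interior (integrableExpSet Real.cosh μ) := by
    refine interior_maximal (fun t (ht : t < 0) ↦ ?_) isOpen_Iio
    rw [integrableExpSet, Set.mem_ofPred_eq, hμ,
      integrable_withDensity_iff_integrable_smul' hmeas (by simp)]
    have := integrableOn_exp_neg_mul_cosh_mul_cosh ν (neg_pos.2 ht)
    simpa [IntegrableOn, ENNReal.toReal_ofReal, hcosh, mul_comm] using this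
  rw [hmgf]
  exact (analyticOn_mgf.contDiffOn isOpen_interior.uniqueDiffOn).comp
    contDiff_neg.contDiffOn fun τ (hτ : 0 < τ) ↦ hsub (neg_lt_zero.2 hτ)

theorem hasDerivAt_integral_Ioi {f : ℝ → ℝ} {a : ℝ} (hf : ContinuousOn f (Set.Ioi a))
    (hint : ∀ r, a < r → MeasureTheory.IntegrableOn f (Set.Ioi r)) {r : ℝ} (hr : a < r) :
    HasDerivAt (fun r ↦ ∫ u in Set.Ioi r, f u) (-f r) r := by
  obtain ⟨b, hab, hbr⟩ := exists_between hr
  have hfr : ContinuousAt f r := hf.continuousAt (Ioi_mem_nhds hr)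
  have h1 : HasDerivAt (fun r ↦ ∫ u in b..r, f u) (f r) r := by
    refine intervalIntegral.integral_hasDerivAt_right ?_ ?_ hfr
    · exact (intervalIntegrable_iff_integrableOn_Ioc_of_le hbr.le).2
        ((hint b hab).mono_set Set.Ioc_subset_Ioi_self)
    · exact hf.stronglyMeasurableAtFilter isOpen_Ioi r hr
  refine (h1.const_sub (∫ u in Set.Ioi b, f u)).congr_of_eventuallyEq ?_
  filter_upwards [Ioi_mem_nhds hr] with x hx
  rw [← intervalIntegral.integral_Ioi_sub_Ioi' (hint b hab) (hint x hx)]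
  ring

theorem contDiffOn_integral_Ioi {f : ℝ → ℝ} {a : ℝ}
    (hf : ContDiffOn ℝ (⊤ : ℕ∞) f (Set.Ioi a))
    (hint : ∀ r, a < r → MeasureTheory.IntegrableOn f (Set.Ioi r)) :
    ContDiffOn ℝ (⊤ : ℕ∞) (fun r ↦ ∫ u in Set.Ioi r, f u) (Set.Ioi a) := by
  have hd {r : ℝ} (hr : a < r) := hasDerivAt_integral_Ioi hf.continuousOn hint hr
  exact (contDiffOn_infty_iff_deriv_of_isOpen isOpen_Ioi).2
    ⟨fun r hr ↦ (hd hr).differentiableAt.differentiableWithinAt,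
      hf.neg.congr fun r hr ↦ (hd hr).deriv⟩

theorem strictAntiOn_integral_Ioi {f : ℝ → ℝ} {a : ℝ} (hf : ContinuousOn f (Set.Ioi a))
    (hint : ∀ r, a < r → MeasureTheory.IntegrableOn f (Set.Ioi r))
    (hpos : ∀ r, a < r → 0 < f r) :
    StrictAntiOn (fun r ↦ ∫ u in Set.Ioi r, f u) (Set.Ioi a) := by
  have hd {r : ℝ} (hr : a < r) := hasDerivAt_integral_Ioi hf hint hr
  refine strictAntiOn_of_deriv_neg (convex_Ioi a)
    (fun r hr ↦ (hd hr).continuousAt.continuousWithinAt) fun r hr ↦ ?_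
  rw [interior_Ioi] at hr
  rw [(hd hr).deriv]
  exact neg_neg_of_pos (hpos r hr)

theorem tendsto_integral_Ioi_atTop {f : ℝ → ℝ} {a : ℝ}
    (hint : MeasureTheory.IntegrableOn f (Set.Ioi a)) :
    Tendsto (fun r ↦ ∫ u in Set.Ioi r, f u) atTop (nhds 0) := by
  have h := (MeasureTheory.intervalIntegral_tendsto_integral_Ioi a hint tendsto_id).const_sub
    (∫ u in Set.Ioi a, f u)
  rw [sub_self] at h
  refine h.congr' ?_
  filter_upwards [eventually_ge_atTop a] with r hr
  rw [id, ← intervalIntegral.integral_Ioi_sub_Ioi hint hr]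
  ring

theorem tendsto_integral_Ioi_atTop_of_sq_inv_le {f : ℝ → ℝ} {c δ : ℝ} (hc : 0 < c) (hδ : 0 < δ)
    (hf : ContinuousOn f (Set.Ioi 0))
    (hint : ∀ r, 0 < r → MeasureTheory.IntegrableOn f (Set.Ioi r))
    (hle : ∀ r, 0 < r → r ≤ δ → c * (r ^ 2)⁻¹ ≤ f r) :
    Tendsto (fun r ↦ ∫ u in Set.Ioi r, f u) (nhdsWithin 0 (Set.Ioi 0)) atTop := by
  set g : ℝ → ℝ := fun r ↦ (∫ u in Set.Ioi r, f u) - c * r⁻¹ with hg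
  have hd {r : ℝ} (hr : 0 < r) : HasDerivAt g (-f r - c * (-(r ^ 2)⁻¹)) r :=
    (hasDerivAt_integral_Ioi hf hint hr).sub ((hasDerivAt_inv hr.ne').const_mul c)
  have hanti : AntitoneOn g (Set.Ioc 0 δ) := by
    refine antitoneOn_of_deriv_nonpos (convex_Ioc 0 δ)
      (fun r hr ↦ (hd hr.1).continuousAt.continuousWithinAt) ?_ ?_
    all_goals rw [interior_Ioc]
    · exact fun r hr ↦ (hd hr.1).differentiableAt.differentiableWithinAt
    · intro r hr
      rw [(hd hr.1).deriv]
      linarith [hle r hr.1 hr.2.le]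
  have h : Tendsto (fun r : ℝ ↦ g δ + c * r⁻¹) (nhdsWithin 0 (Set.Ioi 0)) atTop :=
    tendsto_atTop_add_const_left _ _ (tendsto_inv_nhdsGT_zero.const_mul_atTop hc)
  refine tendsto_atTop_mono' _ ?_ h
  filter_upwards [Ioc_mem_nhdsGT hδ] with r hr
  have := hanti hr ⟨hδ, le_rfl⟩ hr.2
  simp only [hg] at this ⊢
  linarith

theorem contDiffOn_rpow_mul_besselK (a ν : ℝ) {m : ℝ} (hm : 0 < m) :
    ContDiffOn ℝ (⊤ : ℕ∞) (fun u ↦ u ^ a * besselK ν (m * u)) (Set.Ioi 0) := by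
  refine ContDiffOn.mul (fun u (hu : 0 < u) ↦ ?_) ?_
  · exact (Real.contDiffAt_rpow_const_of_ne hu.ne').contDiffWithinAt
  · exact (contDiffOn_besselK ν).comp (by fun_prop) fun u (hu : 0 < u) ↦ mul_pos hm hu

open Asymptotics in
theorem integrableOn_rpow_mul_besselK (a ν : ℝ) {m : ℝ} (hm : 0 < m) {r : ℝ} (hr : 0 < r) :
    MeasureTheory.IntegrableOn (fun u ↦ u ^ a * besselK ν (m * u)) (Set.Ioi r) := by
  refine integrable_of_isBigO_exp_neg (half_pos hm)
    ((contDiffOn_rpow_mul_besselK a ν hm).continuousOn.mono fun u hu ↦ hr.trans_le hu) ?_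
  have h1 : (fun u : ℝ ↦ u ^ a) =O[atTop] fun u ↦ Real.exp (m / 2 * u) :=
    (isLittleO_rpow_exp_pos_mul_atTop a (half_pos hm)).isBigO
  have h2 : (fun u : ℝ ↦ besselK ν (m * u)) =O[atTop] fun u ↦ Real.exp (-m * u) := by
    refine IsBigO.of_bound (Real.exp 1 * besselK ν 1) ?_
    filter_upwards [eventually_ge_atTop (1 / m)] with u hu
    have hmu : 1 ≤ m * u := by
      rwa [div_le_iff₀ hm, mul_comm] at hu
    rw [Real.norm_of_nonneg (besselK_pos ν (by linarith)).le,
      Real.norm_of_nonneg (Real.exp_pos _).le]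
    refine (besselK_le_exp ν hmu).trans_eq ?_
    rw [sub_eq_add_neg, Real.exp_add, neg_mul]
    ring
  refine (h1.mul h2).congr_right fun u ↦ ?_
  rw [← Real.exp_add]
  ring_nf

/-- `l_m` is a strictly increasing smooth function on `(0,∞)` with `l_m(r) → 0` as `r → 0+`
and `l_m(r) → ∞` as `r → ∞`. -/
theorem lm_strictMono_smooth (d : ℕ) (hd : 1 ≤ d) (m : ℝ) (hm : 0 < m) :
    StrictMonoOn (lm d m) (Set.Ioi 0) ∧
    ContDiffOn ℝ (⊤ : ℕ∞) (lm d m) (Set.Ioi 0) ∧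
    Tendsto (lm d m) (nhdsWithin 0 (Set.Ioi 0)) (nhds 0) ∧
    Tendsto (lm d m) atTop atTop := by
  set ν : ℝ := ((d : ℝ) + 1) / 2 with hν
  set a : ℝ := ((d : ℝ) - 3) / 2 with ha
  have hν0 : 0 < ν := by positivity
  set f : ℝ → ℝ := fun u ↦ u ^ a * besselK ν (m * u) with hf
  set I : ℝ → ℝ := fun r ↦ ∫ u in Set.Ioi r, f u with hI
  set C : ℝ := 2 ^ (((d : ℝ) - 1) / 2) * Real.Gamma ν with hC
  have hC0 : 0 < C := mul_pos (by positivity) (Real.Gamma_pos_of_pos hν0)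
  have hM0 : 0 < m ^ ν := Real.rpow_pos_of_pos hm _
  have hlm : lm d m = fun r ↦ C / (m ^ ν * I r) := rfl
  have hsmooth : ContDiffOn ℝ (⊤ : ℕ∞) f (Set.Ioi 0) := contDiffOn_rpow_mul_besselK a ν hm
  have hint (r : ℝ) (hr : 0 < r) := integrableOn_rpow_mul_besselK a ν hm hr
  have hpos (r : ℝ) (hr : 0 < r) : 0 < f r :=
    mul_pos (Real.rpow_pos_of_pos hr _) (besselK_pos ν (mul_pos hm hr))
  have hanti : StrictAntiOn I (Set.Ioi 0) :=
    strictAntiOn_integral_Ioi hsmooth.continuousOn hint hpos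
  have hIpos {r : ℝ} (hr : 0 < r) : 0 < I r := by
    refine lt_of_le_of_lt ?_ (hanti hr (show 0 < r + 1 by linarith) (lt_add_one r))
    refine MeasureTheory.setIntegral_nonneg measurableSet_Ioi fun u hu ↦ (hpos u ?_).le
    have : r + 1 < u := hu
    linarith
  have hzero : Tendsto I (nhdsWithin 0 (Set.Ioi 0)) atTop := by
    refine tendsto_integral_Ioi_atTop_of_sq_inv_le
      (c := Real.exp (-Real.exp 1) / 2 * m ^ (-ν)) (δ := 1 / m) (by positivity) (by positivity)
      hsmooth.continuousOn hint fun r hr hrm ↦ ?_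
    have hmr : m * r ≤ 1 := by rwa [le_div_iff₀ hm, mul_comm] at hrm
    calc _ = r ^ a * (Real.exp (-Real.exp 1) / 2 * (m * r) ^ (-ν)) := by
          have : (r ^ 2)⁻¹ = r ^ a * r ^ (-ν) := by
            rw [← Real.rpow_add hr, show a + -ν = -(2 : ℕ) by rw [ha, hν]; push_cast; ring,
              Real.rpow_neg hr.le, Real.rpow_natCast]
          rw [this, Real.mul_rpow hm.le hr.le]
          ring
      _ ≤ _ := mul_le_mul_of_nonneg_left (rpow_neg_le_besselK hν0.le (mul_pos hm hr) hmr)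
          (by positivity)
  have hinfty : Tendsto I atTop (nhds 0) := tendsto_integral_Ioi_atTop (hint 1 one_pos)
  rw [hlm]
  refine ⟨fun r hr s hs hrs ↦ ?_, ?_, ?_, ?_⟩
  · have h1 := hIpos hs
    exact div_lt_div_of_pos_left hC0 (by positivity)
      (mul_lt_mul_of_pos_left (hanti hr hs hrs) hM0)
  · exact contDiffOn_const.div (contDiffOn_const.mul (contDiffOn_integral_Ioi hsmooth hint))
      fun r hr ↦ (mul_pos hM0 (hIpos hr)).ne'
  · exact (hzero.const_mul_atTop hM0).const_div_atTop C
  · have h : Tendsto (fun r ↦ m ^ ν * I r) atTop (nhdsWithin 0 (Set.Ioi 0)) := by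
      refine tendsto_nhdsWithin_iff.2 ⟨by simpa using hinfty.const_mul (m ^ ν), ?_⟩
      filter_upwards [eventually_gt_atTop 0] with r hr
      exact mul_pos hM0 (hIpos hr)
    exact (tendsto_inv_nhdsGT_zero.comp h).const_mul_atTop hC0
end

section
/- Let d ≥ 1 and 1/2 < β < 1. There exists a constant C = C(d,β) such that for all 0 < m < 1 and 0 ≤ r < s < t, (∫_{ℝ^d} |y|^β k_0^m(y, s−r) dy)(∫_{ℝ^d} |y|^β k_0^m(y, t−s) dy) ≤ C (t−r)^{2β}, where the bound is uniform in m. -/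
/-- The relativistic heat kernel `k_0^m(y,t)` of mass `m`. -/
noncomputable def relKernel (d : ℕ) (m t : ℝ) (y : EuclideanSpace ℝ (Fin d)) : ℝ :=
  2 * (m / (2 * Real.pi)) ^ (((d : ℝ) + 1) / 2) * t * Real.exp (m * t) *
    besselK (((d : ℝ) + 1) / 2) (m * Real.sqrt (‖y‖ ^ 2 + t ^ 2)) *
    (‖y‖ ^ 2 + t ^ 2) ^ (-((d : ℝ) + 1) / 4)

open MeasureTheory Set Filter Topology

lemma pow_le_mul_exp_sq (d : ℕ) {x : ℝ} (hx : 0 ≤ x) :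
    x ^ d ≤ d.factorial * Real.exp 1 * Real.exp (x ^ 2) := by
  have h1 := Real.pow_div_factorial_le_exp x hx d
  rw [div_le_iff₀ (by positivity)] at h1
  calc x ^ d ≤ Real.exp x * d.factorial := h1
    _ ≤ Real.exp (1 + x ^ 2) * d.factorial := by
      gcongr
      nlinarith [sq_nonneg (x - 1)]
    _ = _ := by rw [Real.exp_add]; ring

lemma pow_mul_exp_neg_sq_le (d : ℕ) {x : ℝ} (hx : 0 ≤ x) :
    x ^ d * Real.exp (-x ^ 2) ≤ d.factorial * Real.exp 1 := by
  rw [Real.exp_neg, ← div_eq_mul_inv, div_le_iff₀ (Real.exp_pos _)]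
  exact pow_le_mul_exp_sq d hx

lemma hasDerivAt_arctan_mul_sinh_half (σ s : ℝ) :
    HasDerivAt (fun s => Real.arctan (σ * Real.sinh (s / 2)))
      (1 / (1 + (σ * Real.sinh (s / 2)) ^ 2) * (σ * (Real.cosh (s / 2) * (1 / 2)))) s :=
  ((((hasDerivAt_id s).div_const 2).sinh).const_mul σ).arctan

lemma tendsto_arctan_mul_sinh_half {σ : ℝ} (hσ : 0 < σ) :
    Tendsto (fun s => Real.arctan (σ * Real.sinh (s / 2))) atTop (𝓝 (Real.pi / 2)) := by
  refine (Real.tendsto_arctan_atTop.mono_right nhdsWithin_le_nhds).comp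
    (Tendsto.const_mul_atTop hσ ?_)
  refine tendsto_atTop_mono' _ ?_ (tendsto_id.atTop_div_const two_pos)
  filter_upwards [eventually_ge_atTop 0] with s hs
  exact Real.self_le_sinh_iff.2 (by positivity)

lemma besselK_nonneg (ν τ : ℝ) : 0 ≤ besselK ν τ :=
  integral_nonneg fun s => by have := Real.cosh_pos (ν * s); positivity

lemma besselK_integrand_le (d : ℕ) {σ s : ℝ} (hσ : 0 < σ) (hs : 0 < s) :
    σ ^ (d + 1) * (Real.exp (-σ ^ 2 * Real.cosh s) * Real.cosh (((d : ℝ) + 1) / 2 * s)) ≤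
      2 ^ (2 * d + 2) * (σ ^ d + d.factorial * Real.exp 1) * Real.exp (-σ ^ 2) *
        (1 / (1 + (σ * Real.sinh (s / 2)) ^ 2) * (σ * (Real.cosh (s / 2) * (1 / 2)))) := by
  set w := Real.sinh (s / 2) with hw
  set c := Real.cosh (s / 2) with hc
  set A : ℝ := d.factorial * Real.exp 1 with hA
  have hw0 : 0 ≤ w := Real.sinh_nonneg_iff.2 (by positivity)
  have hc0 : 0 < c := Real.cosh_pos _
  have hcw : c ≤ 1 + w := by
    have := Real.cosh_sq (s / 2)
    rw [← hw, ← hc] at this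
    nlinarith
  have hcosh : Real.cosh s = 1 + 2 * w ^ 2 := by
    have h1 := Real.cosh_two_mul (s / 2)
    have h2 := Real.cosh_sq (s / 2)
    rw [mul_div_cancel₀ s two_ne_zero] at h1
    rw [h1, h2]
    ring
  have hnu : Real.cosh (((d : ℝ) + 1) / 2 * s) ≤ (2 * c) ^ (d + 1) := by
    have h1 : Real.cosh (((d : ℝ) + 1) / 2 * s) ≤ Real.exp (((d : ℝ) + 1) / 2 * s) := by
      rw [← Real.cosh_add_sinh]
      exact le_add_of_nonneg_right (Real.sinh_nonneg_iff.2 (by positivity))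
    have h2 : Real.exp (((d : ℝ) + 1) / 2 * s) = Real.exp (s / 2) ^ (d + 1) := by
      rw [← Real.exp_nat_mul]
      push_cast
      ring_nf
    rw [h2] at h1
    refine h1.trans (pow_le_pow_left₀ (Real.exp_pos _).le ?_ _)
    rw [hc, Real.cosh_eq]
    linarith [Real.exp_pos (-(s / 2))]
  have hpow : σ ^ d * c ^ d ≤ 2 ^ d * (σ ^ d + (σ * w) ^ d) := by
    calc σ ^ d * c ^ d = (σ * c) ^ d := (mul_pow _ _ _).symm
      _ ≤ (σ + σ * w) ^ d := by gcongr; nlinarith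
      _ ≤ 2 ^ (d - 1) * (σ ^ d + (σ * w) ^ d) := add_pow_le hσ.le (by positivity) d
      _ ≤ _ := by gcongr <;> simp
  have hexp : Real.exp (-(σ * w) ^ 2) ≤ 1 / (1 + (σ * w) ^ 2) := by
    rw [Real.exp_neg, ← one_div]
    gcongr
    linarith [Real.add_one_le_exp ((σ * w) ^ 2)]
  have hbd : (σ ^ d + (σ * w) ^ d) * Real.exp (-(σ * w) ^ 2) ≤ σ ^ d + A := by
    have h1 := pow_mul_exp_neg_sq_le d (x := σ * w) (by positivity)
    have h2 : Real.exp (-(σ * w) ^ 2) ≤ 1 := Real.exp_le_one_iff.2 (by nlinarith [sq_nonneg (σ * w)])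
    have h3 : 0 ≤ σ ^ d := by positivity
    nlinarith
  have hsplit : Real.exp (-σ ^ 2 * Real.cosh s) =
      Real.exp (-σ ^ 2) * (Real.exp (-(σ * w) ^ 2) * Real.exp (-(σ * w) ^ 2)) := by
    rw [hcosh, ← Real.exp_add, ← Real.exp_add]
    ring_nf
  calc _ ≤ σ ^ (d + 1) * (Real.exp (-σ ^ 2 * Real.cosh s) * (2 * c) ^ (d + 1)) := by gcongr
    _ = 2 ^ (d + 1) * Real.exp (-σ ^ 2) * (σ * c) * (σ ^ d * c ^ d) *
        (Real.exp (-(σ * w) ^ 2) * Real.exp (-(σ * w) ^ 2)) := by rw [hsplit]; ring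
    _ ≤ 2 ^ (d + 1) * Real.exp (-σ ^ 2) * (σ * c) * (2 ^ d * (σ ^ d + (σ * w) ^ d)) *
        (Real.exp (-(σ * w) ^ 2) * (1 / (1 + (σ * w) ^ 2))) := by gcongr
    _ = 2 ^ (2 * d + 1) * Real.exp (-σ ^ 2) * (σ * c) *
        ((σ ^ d + (σ * w) ^ d) * Real.exp (-(σ * w) ^ 2)) * (1 / (1 + (σ * w) ^ 2)) := by ring
    _ ≤ 2 ^ (2 * d + 1) * Real.exp (-σ ^ 2) * (σ * c) * (σ ^ d + A) *
        (1 / (1 + (σ * w) ^ 2)) := by gcongr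
    _ = _ := by ring

lemma pow_mul_besselK_le (d : ℕ) {σ : ℝ} (hσ : 0 < σ) :
    σ ^ (d + 1) * besselK (((d : ℝ) + 1) / 2) (σ ^ 2) ≤
      2 ^ (2 * d + 2) * (σ ^ d + d.factorial * Real.exp 1) * Real.exp (-σ ^ 2) *
        (Real.pi / 2) := by
  have hpos : ∀ s ∈ Ioi (0 : ℝ), 0 ≤
      1 / (1 + (σ * Real.sinh (s / 2)) ^ 2) * (σ * (Real.cosh (s / 2) * (1 / 2))) := fun s _ => by
    have := Real.cosh_pos (s / 2)
    positivity
  have hint := integrableOn_Ioi_deriv_of_nonneg'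
    (fun s _ => hasDerivAt_arctan_mul_sinh_half σ s) hpos (tendsto_arctan_mul_sinh_half hσ)
  have hval := integral_Ioi_of_hasDerivAt_of_nonneg'
    (fun s _ => hasDerivAt_arctan_mul_sinh_half σ s) hpos (tendsto_arctan_mul_sinh_half hσ)
  simp only [zero_div, Real.sinh_zero, mul_zero, Real.arctan_zero, sub_zero] at hval
  rw [besselK, ← hval, ← integral_const_mul, ← integral_const_mul]
  refine integral_mono_of_nonneg (ae_of_all _ fun s => ?_) (hint.const_mul _) ?_
  · have := Real.cosh_pos (((d : ℝ) + 1) / 2 * s)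
    positivity
  · filter_upwards [ae_restrict_mem measurableSet_Ioi] with s hs
    exact besselK_integrand_le d hσ hs

lemma relKernel_nonneg (d : ℕ) {m t : ℝ} (hm : 0 ≤ m) (ht : 0 ≤ t)
    (y : EuclideanSpace ℝ (Fin d)) : 0 ≤ relKernel d m t y := by
  have := besselK_nonneg (((d : ℝ) + 1) / 2) (m * Real.sqrt (‖y‖ ^ 2 + t ^ 2))
  unfold relKernel
  positivity

lemma relKernel_eq (d : ℕ) {m t : ℝ} (hm : 0 < m) (ht : 0 < t)
    (y : EuclideanSpace ℝ (Fin d)) :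
    relKernel d m t y = 2 * (2 * Real.pi) ^ (-(((d : ℝ) + 1) / 2)) * t * Real.exp (m * t) *
      (Real.sqrt (m * Real.sqrt (‖y‖ ^ 2 + t ^ 2)) ^ (d + 1) *
        besselK (((d : ℝ) + 1) / 2) (Real.sqrt (m * Real.sqrt (‖y‖ ^ 2 + t ^ 2)) ^ 2)) /
      Real.sqrt (‖y‖ ^ 2 + t ^ 2) ^ (d + 1) := by
  set R := Real.sqrt (‖y‖ ^ 2 + t ^ 2) with hR
  have hR0 : 0 < R := by positivity
  have hRsq : ‖y‖ ^ 2 + t ^ 2 = R ^ 2 := (Real.sq_sqrt (by positivity)).symm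
  have h1 : Real.sqrt (m * R) ^ (d + 1) =
      m ^ (((d : ℝ) + 1) / 2) * R ^ (((d : ℝ) + 1) / 2) := by
    rw [← Real.mul_rpow hm.le hR0.le, Real.sqrt_eq_rpow,
      ← Real.rpow_natCast, ← Real.rpow_mul (by positivity)]
    push_cast
    ring_nf
  have h2 : (R ^ 2) ^ (-((d : ℝ) + 1) / 4) = (R ^ (((d : ℝ) + 1) / 2))⁻¹ := by
    rw [← Real.rpow_natCast, ← Real.rpow_mul hR0.le, ← Real.rpow_neg hR0.le]
    push_cast
    ring_nf
  have h3 : R ^ (d + 1) = R ^ (((d : ℝ) + 1) / 2) * R ^ (((d : ℝ) + 1) / 2) := by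
    rw [← Real.rpow_add hR0, ← Real.rpow_natCast]
    push_cast
    ring_nf
  have h4 : 0 < R ^ (((d : ℝ) + 1) / 2) := by positivity
  rw [relKernel, ← hR, Real.sq_sqrt (by positivity), h1, h3, hRsq, h2,
    Real.div_rpow hm.le (by positivity), Real.rpow_neg (by positivity)]
  field_simp

/-- The mass-independent majorant: the kernel is `O(t |y|^{-d} (|y|² + t²)^{-1/2})`. -/
lemma exists_relKernel_le (d : ℕ) : ∃ C : ℝ, 0 ≤ C ∧ ∀ m t : ℝ, 0 < m → 0 < t →
    ∀ y : EuclideanSpace ℝ (Fin d), y ≠ 0 →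
      relKernel d m t y ≤ C * (t / (‖y‖ ^ d * Real.sqrt (‖y‖ ^ 2 + t ^ 2))) := by
  set A : ℝ := d.factorial * Real.exp 1 with hA
  have hA0 : 0 ≤ A := by positivity
  set B : ℝ := 2 ^ (2 * d + 2) * (Real.pi / 2) with hB
  have hB0 : 0 ≤ B := by positivity
  set D : ℝ := 2 * (2 * Real.pi) ^ (-(((d : ℝ) + 1) / 2)) with hD
  have hD0 : 0 ≤ D := by positivity
  refine ⟨D * B * (A + A) * 2 ^ d, by positivity, fun m t hm ht y hy => ?_⟩
  have hy0 : 0 < ‖y‖ := norm_pos_iff.2 hy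
  rw [relKernel_eq d hm ht]
  set R := Real.sqrt (‖y‖ ^ 2 + t ^ 2) with hR
  have hR0 : 0 < R := by positivity
  have hRsq : R ^ 2 = ‖y‖ ^ 2 + t ^ 2 := Real.sq_sqrt (by positivity)
  set σ := Real.sqrt (m * R) with hσ
  have hσ0 : 0 < σ := by positivity
  have hσsq : σ ^ 2 = m * R := Real.sq_sqrt (by positivity)
  set u := ‖y‖ / (2 * R) with hu
  have hu0 : 0 < u := by positivity
  have htR : t ≤ R := by nlinarith [sq_nonneg ‖y‖]
  have hyR : ‖y‖ ≤ R := by nlinarith [sq_nonneg t]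
  have hu1 : u ≤ 1 := by
    rw [hu, div_le_one (by positivity)]
    linarith
  have hgap : (σ * u) ^ 2 ≤ σ ^ 2 - m * t := by
    have h1 : (σ * u) ^ 2 = m * (‖y‖ ^ 2 / (4 * R)) := by
      rw [mul_pow, hσsq, hu]
      field_simp
      ring
    have h2 : ‖y‖ ^ 2 / (4 * R) ≤ R - t := by
      rw [div_le_iff₀ (by positivity)]
      nlinarith
    rw [h1, hσsq, ← mul_sub]
    gcongr
  have hexp : Real.exp (m * t) * Real.exp (-σ ^ 2) ≤ Real.exp (-(σ * u) ^ 2) := by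
    rw [← Real.exp_add]
    gcongr
    linarith
  have hkey : (σ ^ d + A) * Real.exp (-(σ * u) ^ 2) ≤ (A + A) / u ^ d := by
    rw [le_div_iff₀ (by positivity)]
    have h1 := pow_mul_exp_neg_sq_le d (x := σ * u) (by positivity)
    have h2 : Real.exp (-(σ * u) ^ 2) ≤ 1 :=
      Real.exp_le_one_iff.2 (by nlinarith [sq_nonneg (σ * u)])
    have h3 : Real.exp (-(σ * u) ^ 2) * u ^ d ≤ 1 :=
      mul_le_one₀ h2 (by positivity) (pow_le_one₀ hu0.le hu1)
    rw [mul_pow] at h1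
    nlinarith
  calc D * t * Real.exp (m * t) * (σ ^ (d + 1) * besselK (((d : ℝ) + 1) / 2) (σ ^ 2)) / R ^ (d + 1)
      ≤ D * t * Real.exp (m * t) * (2 ^ (2 * d + 2) * (σ ^ d + A) * Real.exp (-σ ^ 2) *
          (Real.pi / 2)) / R ^ (d + 1) := by
        gcongr D * t * Real.exp (m * t) * ?_ / R ^ (d + 1)
        exact pow_mul_besselK_le d hσ0
    _ = D * B * t * ((σ ^ d + A) * (Real.exp (m * t) * Real.exp (-σ ^ 2))) / R ^ (d + 1) := by
        rw [hB]; ring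
    _ ≤ D * B * t * ((σ ^ d + A) * Real.exp (-(σ * u) ^ 2)) / R ^ (d + 1) := by gcongr
    _ ≤ D * B * t * ((A + A) / u ^ d) / R ^ (d + 1) := by gcongr
    _ = _ := by
        rw [hu, div_pow, mul_pow, pow_succ R d]
        field_simp

lemma integrableOn_rpow_div_sqrt {β : ℝ} (hβ0 : 0 < β) (hβ1 : β < 1) :
    IntegrableOn (fun x : ℝ => x ^ (β - 1) / Real.sqrt (x ^ 2 + 1)) (Ioi 0) := by
  have hmeas : Measurable (fun x : ℝ => x ^ (β - 1) / Real.sqrt (x ^ 2 + 1)) := by fun_prop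
  rw [← Ioc_union_Ioi_eq_Ioi zero_le_one]
  refine IntegrableOn.union ?_ ?_
  · have h : IntegrableOn (fun x : ℝ => x ^ (β - 1)) (Ioc 0 1) :=
      (intervalIntegral.intervalIntegrable_rpow' (by linarith)).1
    refine Integrable.mono' h hmeas.aestronglyMeasurable ?_
    filter_upwards [ae_restrict_mem measurableSet_Ioc] with x hx
    have hx0 : 0 < x := hx.1
    rw [Real.norm_of_nonneg (by positivity)]
    refine div_le_self (by positivity) (Real.one_le_sqrt.2 ?_)
    nlinarith
  · refine Integrable.mono' (integrableOn_Ioi_rpow_of_lt (a := β - 2) (by linarith) one_pos)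
      hmeas.aestronglyMeasurable ?_
    filter_upwards [ae_restrict_mem measurableSet_Ioi] with x hx
    have hx0 : 0 < x := one_pos.trans hx
    rw [Real.norm_of_nonneg (by positivity), show β - 2 = β - 1 - 1 by ring,
      Real.rpow_sub_one hx0.ne' (β - 1)]
    gcongr
    exact Real.le_sqrt_of_sq_le (by linarith)

lemma integrable_norm_rpow_div_sqrt {d : ℕ} (hd : 1 ≤ d) {β : ℝ} (hβ0 : 0 < β) (hβ1 : β < 1) :
    Integrable (fun z : EuclideanSpace ℝ (Fin d) =>
      ‖z‖ ^ (β - d) / Real.sqrt (‖z‖ ^ 2 + 1)) := by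
  have : Nonempty (Fin d) := ⟨⟨0, hd⟩⟩
  refine (integrable_fun_norm_addHaar (E := EuclideanSpace ℝ (Fin d)) volume
    (f := fun x : ℝ => x ^ (β - d) / Real.sqrt (x ^ 2 + 1))).2 ?_
  refine (integrableOn_rpow_div_sqrt hβ0 hβ1).congr_fun (fun x hx => ?_) measurableSet_Ioi
  have hx0 : (0 : ℝ) < x := hx
  simp only [finrank_euclideanSpace, Fintype.card_fin, smul_eq_mul]
  rw [← mul_div_assoc, ← Real.rpow_natCast x (d - 1), ← Real.rpow_add hx0, Nat.cast_sub hd]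
  push_cast
  ring_nf

/-- The `β`-moment of the kernel at time `t` is `O(t^β)`, uniformly in the mass. -/
lemma exists_moment_le {d : ℕ} (hd : 1 ≤ d) {β : ℝ} (hβ0 : 0 < β) (hβ1 : β < 1) :
    ∃ C : ℝ, 0 ≤ C ∧ ∀ m t : ℝ, 0 < m → 0 < t →
      ∫ y : EuclideanSpace ℝ (Fin d), ‖y‖ ^ β * relKernel d m t y ≤ C * t ^ β := by
  obtain ⟨C, hC0, hC⟩ := exists_relKernel_le d
  set g : EuclideanSpace ℝ (Fin d) → ℝ :=
    fun z => ‖z‖ ^ (β - d) / Real.sqrt (‖z‖ ^ 2 + 1) with hg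
  have hg0 : ∀ z, 0 ≤ g z := fun z => by positivity
  have hgi : Integrable g := integrable_norm_rpow_div_sqrt hd hβ0 hβ1
  refine ⟨C * ∫ z, g z, mul_nonneg hC0 (integral_nonneg hg0), fun m t hm ht => ?_⟩
  have hscale : ∀ y : EuclideanSpace ℝ (Fin d), y ≠ 0 →
      ‖y‖ ^ β * (t / (‖y‖ ^ d * Real.sqrt (‖y‖ ^ 2 + t ^ 2))) =
        t ^ (β - d) * g (t⁻¹ • y) := fun y hy => by
    have hy0 : 0 < ‖y‖ := norm_pos_iff.2 hy
    have h1 : Real.sqrt ((t⁻¹ * ‖y‖) ^ 2 + 1) = t⁻¹ * Real.sqrt (‖y‖ ^ 2 + t ^ 2) := by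
      rw [show (t⁻¹ * ‖y‖) ^ 2 + 1 = t⁻¹ ^ 2 * (‖y‖ ^ 2 + t ^ 2) by field_simp,
        Real.sqrt_mul (by positivity), Real.sqrt_sq (by positivity)]
    simp only [hg, norm_smul, norm_inv, Real.norm_of_nonneg ht.le]
    rw [h1, Real.mul_rpow (by positivity) hy0.le, Real.inv_rpow ht.le, Real.rpow_sub hy0,
      Real.rpow_natCast]
    have h2 : 0 < t ^ (β - d) := by positivity
    field_simp
  calc ∫ y, ‖y‖ ^ β * relKernel d m t y
      ≤ ∫ y, C * (t ^ (β - d) * g (t⁻¹ • y)) := by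
        refine integral_mono_of_nonneg
          (ae_of_all _ fun y => mul_nonneg (by positivity) (relKernel_nonneg d hm.le ht.le y))
          (((hgi.comp_smul (inv_ne_zero ht.ne')).const_mul _).const_mul _)
          (ae_of_all _ fun y => ?_)
        rcases eq_or_ne y 0 with rfl | hy
        · have := hg0 (t⁻¹ • (0 : EuclideanSpace ℝ (Fin d)))
          simp only [norm_zero, Real.zero_rpow hβ0.ne', zero_mul]
          positivity
        · simp only [← hscale y hy]
          rw [mul_left_comm]
          gcongr
          exact hC m t hm ht y hy
    _ = (C * ∫ z, g z) * t ^ β := by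
        rw [integral_const_mul, integral_const_mul, Measure.integral_comp_inv_smul,
          finrank_euclideanSpace, Fintype.card_fin, smul_eq_mul, abs_of_pos (by positivity),
          Real.rpow_sub ht, Real.rpow_natCast]
        field_simp

/-- For `d ≥ 1` and `1/2 < β < 1`, there is a constant `C = C(d,β)` such that, uniformly in
`0 < m < 1` and `0 ≤ r < s < t`,
`(∫ |y|^β k_0^m(y,s−r) dy)(∫ |y|^β k_0^m(y,t−s) dy) ≤ C (t−r)^{2β}`. -/
theorem moment_product_bound (d : ℕ) (hd : 1 ≤ d) (β : ℝ) (hβ1 : 1 / 2 < β) (hβ2 : β < 1) :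
    ∃ C : ℝ, ∀ m : ℝ, 0 < m → m < 1 → ∀ r s t : ℝ, 0 ≤ r → r < s → s < t →
      (∫ y : EuclideanSpace ℝ (Fin d), ‖y‖ ^ β * relKernel d m (s - r) y) *
        (∫ y : EuclideanSpace ℝ (Fin d), ‖y‖ ^ β * relKernel d m (t - s) y) ≤
      C * (t - r) ^ (2 * β) := by
  obtain ⟨C, hC0, hC⟩ := exists_moment_le hd (β := β) (by linarith) hβ2
  refine ⟨C * C, fun m hm _ r s t _ hrs hst => ?_⟩
  have h1 : 0 < s - r := sub_pos.2 hrs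
  have h2 : 0 < t - s := sub_pos.2 hst
  have h3 : 0 < t - r := by linarith
  calc _ ≤ (C * (s - r) ^ β) * (C * (t - s) ^ β) :=
        mul_le_mul (hC m _ hm h1) (hC m _ hm h2)
          (integral_nonneg fun y => mul_nonneg (by positivity) (relKernel_nonneg d hm.le h2.le y))
          (by positivity)
    _ ≤ (C * (t - r) ^ β) * (C * (t - r) ^ β) := by gcongr
    _ = C * C * (t - r) ^ (2 * β) := by
        rw [two_mul, Real.rpow_add h3]
        ring
end

section
/- Let χ ∈ C_0^∞(ℝ^d) be nonnegative with χ(x) = 1 for |x| ≤ 1/2 and χ(x) = 0 for |x| ≥ 1, let h ∈ C_0^∞(ℝ^d) be nonnegative, and let P_t^m denote the Fourier multiplier with symbol e^{−t(√(|ξ|²+m²)−m)}. Then ∫_{ℝ^d} (1 − χ(x/R)) (P_t^m h)(x) dx → 0 as R → ∞, uniformly in t ∈ [0,T] and m ∈ [0,1]. -/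
open MeasureTheory
open scoped RealInnerProductSpace

/-- The free relativistic semigroup of mass `m` applied to `h`, as the Fourier multiplier with
symbol `e^{−t(√(|ξ|²+m²)−m)}`:
`(P_t^m h)(x) = (2π)^{−d} ∫ e^{ix·ξ} e^{−t(√(|ξ|²+m²)−m)} ĥ(ξ) dξ`,
where `ĥ(ξ) = ∫ e^{−iz·ξ} h(z) dz`. -/
noncomputable def relSemigroup (d : ℕ) (t m : ℝ) (h : EuclideanSpace ℝ (Fin d) → ℝ)
    (x : EuclideanSpace ℝ (Fin d)) : ℂ :=
  (((2 * Real.pi) ^ (-(d : ℝ)) : ℝ) : ℂ) *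
    ∫ ξ : EuclideanSpace ℝ (Fin d),
      Complex.exp (Complex.I * (⟪x, ξ⟫ : ℝ)) *
        Complex.exp (-(t * (Real.sqrt (‖ξ‖ ^ 2 + m ^ 2) - m)) : ℝ) *
        ∫ z : EuclideanSpace ℝ (Fin d), Complex.exp (-(Complex.I * (⟪z, ξ⟫ : ℝ))) * (h z : ℂ)

open FourierTransform SchwartzMap

section Schwartz

variable {V : Type*} [NormedAddCommGroup V] [InnerProductSpace ℝ V]

lemma SchwartzMap.exists_norm_le (f : 𝓢(V, ℂ)) : ∃ C, 0 ≤ C ∧ ∀ x, ‖f x‖ ≤ C := by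
  obtain ⟨C, hC, h⟩ := f.decay 0 0
  exact ⟨C, hC.le, fun x => by simpa using h x⟩

lemma SchwartzMap.exists_norm_sub_zero_le (f : 𝓢(V, ℂ)) :
    ∃ C, 0 ≤ C ∧ ∀ x, ‖f x - f 0‖ ≤ C * ‖x‖ := by
  obtain ⟨C, hC, h⟩ := f.decay 0 1
  refine ⟨C, hC.le, fun x => ?_⟩
  have := convex_univ.norm_image_sub_le_of_norm_fderiv_le (𝕜 := ℝ) (f := f) (C := C)
    (fun x _ => f.differentiableAt) (fun x _ => by simpa [norm_iteratedFDeriv_one] using h x)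
    (Set.mem_univ 0) (Set.mem_univ x)
  simpa using this

end Schwartz

section Fourier

variable {V : Type*} [NormedAddCommGroup V] [InnerProductSpace ℝ V] [MeasurableSpace V]
  [BorelSpace V] [FiniteDimensional ℝ V]

/-- The inverse Fourier transform is self-adjoint on integrable functions. -/
lemma integral_mul_fourierInv_eq {f g : V → ℂ} (hf : Integrable f) (hg : Integrable g) :
    ∫ x, f x * 𝓕⁻ g x = ∫ w, 𝓕⁻ f w * g w := by
  have key : ∫ w, 𝓕 f w * g (-w) = ∫ x, f x * 𝓕 (fun w => g (-w)) x := by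
    simpa using! VectorFourier.integral_fourierIntegral_smul_eq_flip (L := innerₗ V)
      Real.continuous_fourierChar continuous_inner hf hg.comp_neg
  rw [Real.fourierInv_eq_fourier_comp_neg g, ← key,
    ← integral_neg_eq_self (fun w => 𝓕 f w * g (-w))]
  simp [Real.fourierInv_eq_fourier_neg]

lemma fourierInv_comp_inv_smul (g : V → ℂ) {R : ℝ} (hR : 0 < R) (y : V) :
    𝓕⁻ (fun w => g (R⁻¹ • w)) y = R ^ Module.finrank ℝ V • 𝓕⁻ g (R • y) := by
  rw [Real.fourierInv_eq, Real.fourierInv_eq,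
    ← Measure.integral_comp_inv_smul_of_nonneg volume _ hR.le]
  congr 1 with w
  simp [inner_smul_left, inner_smul_right, hR.ne']

lemma integral_fourierInv_eq {g : V → ℂ} (hgc : Continuous g) (hg : Integrable g)
    (hg' : Integrable (𝓕⁻ g)) : ∫ x, 𝓕⁻ g x = g 0 := by
  have hF : Integrable (𝓕 g) := by
    have := hg'.comp_neg
    simpa [Real.fourierInv_eq_fourier_neg] using this
  have := congrFun (hgc.fourier_fourierInv_eq hg hF) 0
  simpa [Real.fourier_eq'] using this

lemma continuous_fourierInv {g : V → ℂ} (hg : Integrable g) : Continuous (𝓕⁻ g) := by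
  rw [Real.fourierInv_eq_fourier_comp_neg]
  exact VectorFourier.fourierIntegral_continuous Real.continuous_fourierChar
    continuous_inner hg.comp_neg

lemma norm_fourierInv_le (g : V → ℂ) (x : V) : ‖𝓕⁻ g x‖ ≤ ∫ w, ‖g w‖ := by
  rw [Real.fourierInv_eq]
  refine (norm_integral_le_integral_norm _).trans_eq ?_
  simp

/-- A frequency-side bound for the mass of `𝓕⁻ g` outside a smooth cutoff. -/
lemma norm_integral_one_sub_mul_fourierInv_le (χ : 𝓢(V, ℂ)) (hχ : χ 0 = 1) {g : V → ℂ}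
    (hgc : Continuous g) (hg : Integrable g) {K : ℝ} (hK : 0 ≤ K)
    (hgK : ∀ w, ‖g w - g 0‖ ≤ K * ‖w‖) :
    ‖∫ x, (1 - χ x) * 𝓕⁻ g x‖ ≤ K * ∫ w, ‖w‖ * ‖(𝓕⁻ χ) w‖ := by
  by_cases hint : Integrable fun x => (1 - χ x) * 𝓕⁻ g x
  swap
  · rw [integral_undef hint, norm_zero]
    positivity
  have hχg : Integrable fun x => χ x * 𝓕⁻ g x :=
    χ.integrable.mul_bdd (continuous_fourierInv hg).aestronglyMeasurable
      (Filter.Eventually.of_forall (norm_fourierInv_le g))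
  have hinv : Integrable (𝓕⁻ g) := by
    refine (hint.add hχg).congr (Filter.Eventually.of_forall fun x => ?_)
    simp only [Pi.add_apply]
    ring
  have hψ : Integrable (𝓕⁻ (χ : V → ℂ)) := by
    rw [← fourierInv_coe]
    exact (𝓕⁻ χ).integrable
  have hψg : Integrable fun w => 𝓕⁻ (χ : V → ℂ) w * g w :=
    hg.bdd_mul (continuous_fourierInv χ.integrable).aestronglyMeasurable
      (Filter.Eventually.of_forall (norm_fourierInv_le χ))
  have hχ0 : ∫ w, 𝓕⁻ (χ : V → ℂ) w = 1 := by
    rw [integral_fourierInv_eq χ.continuous χ.integrable hψ, hχ]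
  have heq : ∫ x, (1 - χ x) * 𝓕⁻ g x = -∫ w, 𝓕⁻ (χ : V → ℂ) w * (g w - g 0) := by
    simp only [sub_mul, one_mul, mul_sub]
    rw [integral_sub hinv hχg, integral_sub hψg (hψ.mul_const _), integral_mul_const, hχ0,
      integral_mul_fourierInv_eq χ.integrable hg, integral_fourierInv_eq hgc hg hinv]
    ring
  rw [heq, norm_neg, ← integral_const_mul]
  have hmom : Integrable fun w => ‖w‖ * ‖(𝓕⁻ χ) w‖ := by
    have := (𝓕⁻ χ).integrable_pow_mul volume 1
    simp only [pow_one] at this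
    exact this
  refine norm_integral_le_of_norm_le (hmom.const_mul K) (Filter.Eventually.of_forall fun w => ?_)
  rw [norm_mul, fourierInv_coe]
  calc ‖𝓕⁻ (χ : V → ℂ) w‖ * ‖g w - g 0‖ ≤ ‖𝓕⁻ (χ : V → ℂ) w‖ * (K * ‖w‖) := by
        gcongr
        exact hgK w
    _ = _ := by ring

end Fourier

lemma Real.sqrt_sq_add_sq_sub_mem_Icc {a m : ℝ} (ha : 0 ≤ a) (hm : 0 ≤ m) :
    Real.sqrt (a ^ 2 + m ^ 2) - m ∈ Set.Icc 0 a := by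
  constructor
  · exact sub_nonneg.2 (Real.le_sqrt_of_sq_le (by nlinarith))
  · rw [sub_le_iff_le_add]
    exact Real.sqrt_le_iff.2 ⟨by positivity, by nlinarith [mul_nonneg ha hm]⟩

/-- The symbol of the relativistic semigroup in the frequency variable `w = ξ / 2π`. -/
noncomputable def relSymbol (d : ℕ) (t m : ℝ) (w : EuclideanSpace ℝ (Fin d)) : ℝ :=
  Real.exp (-(t * (Real.sqrt (‖(2 * Real.pi) • w‖ ^ 2 + m ^ 2) - m)))

lemma continuous_relSymbol (d : ℕ) (t m : ℝ) : Continuous (relSymbol d t m) := by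
  unfold relSymbol
  fun_prop

lemma relSymbol_zero {d : ℕ} {t m : ℝ} (hm : 0 ≤ m) : relSymbol d t m 0 = 1 := by
  simp [relSymbol, Real.sqrt_sq hm]

lemma relSymbol_le_one {d : ℕ} {t m : ℝ} (ht : 0 ≤ t) (hm : 0 ≤ m)
    (w : EuclideanSpace ℝ (Fin d)) :
    relSymbol d t m w ≤ 1 := by
  have := Real.sqrt_sq_add_sq_sub_mem_Icc (norm_nonneg ((2 * Real.pi) • w)) hm
  exact Real.exp_le_one_iff.2 (neg_nonpos.2 (mul_nonneg ht this.1))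

lemma one_sub_relSymbol_le {d : ℕ} {t m : ℝ} (ht : 0 ≤ t) (hm : 0 ≤ m)
    (w : EuclideanSpace ℝ (Fin d)) :
    1 - relSymbol d t m w ≤ t * (2 * Real.pi) * ‖w‖ := by
  have h1 := Real.sqrt_sq_add_sq_sub_mem_Icc (norm_nonneg ((2 * Real.pi) • w)) hm
  have h2 := Real.add_one_le_exp
    (-(t * (Real.sqrt (‖(2 * Real.pi) • w‖ ^ 2 + m ^ 2) - m)))
  have h3 := mul_le_mul_of_nonneg_left h1.2 ht
  have h4 : ‖(2 * Real.pi) • w‖ = 2 * Real.pi * ‖w‖ := by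
    rw [norm_smul, Real.norm_of_nonneg (by positivity)]
  have h5 : t * ‖(2 * Real.pi) • w‖ = t * (2 * Real.pi) * ‖w‖ := by
    rw [h4]
    ring
  unfold relSymbol
  linarith

lemma relSemigroup_eq_fourierInv (d : ℕ) (t m : ℝ) (h : EuclideanSpace ℝ (Fin d) → ℝ)
    (x : EuclideanSpace ℝ (Fin d)) :
    relSemigroup d t m h x =
      𝓕⁻ (fun w => (relSymbol d t m w : ℂ) * 𝓕 (fun z => (h z : ℂ)) w) x := by
  have hpi : 0 < 2 * Real.pi := by positivity
  have hcov := Measure.integral_comp_smul_of_nonneg (volume : Measure (EuclideanSpace ℝ (Fin d)))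
    (fun ξ => Complex.exp (Complex.I * (⟪x, ξ⟫ : ℝ)) *
        Complex.exp (-(t * (Real.sqrt (‖ξ‖ ^ 2 + m ^ 2) - m)) : ℝ) *
        ∫ z : EuclideanSpace ℝ (Fin d), Complex.exp (-(Complex.I * (⟪z, ξ⟫ : ℝ))) * (h z : ℂ))
    (2 * Real.pi) (hR := hpi.le)
  have hconst : (2 * Real.pi) ^ (-(d : ℝ)) =
      ((2 * Real.pi) ^ Module.finrank ℝ (EuclideanSpace ℝ (Fin d)))⁻¹ := by
    rw [Real.rpow_neg hpi.le, Real.rpow_natCast, finrank_euclideanSpace_fin]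
  rw [relSemigroup, hconst, ← Complex.real_smul, ← hcov, Real.fourierInv_eq']
  congr 1 with w
  rw [Real.fourier_eq', smul_eq_mul, ← mul_assoc, relSymbol, Complex.ofReal_exp]
  congr 2
  · rw [mul_comm Complex.I]
    congr 3
    rw [inner_smul_right, real_inner_comm]
  · congr 1 with z
    rw [smul_eq_mul]
    congr 2
    rw [inner_smul_right]
    push_cast
    ring

/-- `∫ (1 − χ(x/R)) (P_t^m h)(x) dx → 0` as `R → ∞`, uniformly in `t ∈ [0,T]` and
`m ∈ [0,1]`. -/
theorem tail_mass_vanishes_uniformly (d : ℕ) (hd : 1 ≤ d) (T : ℝ) (hT : 0 < T)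
    (χ h : EuclideanSpace ℝ (Fin d) → ℝ)
    (hχ_smooth : ContDiff ℝ (⊤ : ℕ∞) χ) (hχ_supp : HasCompactSupport χ) (hχ_nonneg : ∀ x, 0 ≤ χ x)
    (hχ_one : ∀ x : EuclideanSpace ℝ (Fin d), ‖x‖ ≤ 1 / 2 → χ x = 1)
    (hχ_zero : ∀ x : EuclideanSpace ℝ (Fin d), 1 ≤ ‖x‖ → χ x = 0)
    (hh_smooth : ContDiff ℝ (⊤ : ℕ∞) h) (hh_supp : HasCompactSupport h) (hh_nonneg : ∀ x, 0 ≤ h x) :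
    ∀ ε : ℝ, 0 < ε → ∃ R₀ : ℝ, ∀ R : ℝ, R₀ ≤ R → ∀ t ∈ Set.Icc (0 : ℝ) T,
      ∀ m ∈ Set.Icc (0 : ℝ) 1,
      ‖∫ x : EuclideanSpace ℝ (Fin d),
          ((1 - χ (R⁻¹ • x) : ℝ) : ℂ) * relSemigroup d t m h x‖ ≤ ε := by
  intro ε hε
  let H : 𝓢(EuclideanSpace ℝ (Fin d), ℂ) :=
    HasCompactSupport.toSchwartzMap (f := fun z => (h z : ℂ))
      (hh_supp.comp_left Complex.ofReal_zero) (Complex.ofRealCLM.contDiff.comp hh_smooth)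
  let X : 𝓢(EuclideanSpace ℝ (Fin d), ℂ) :=
    HasCompactSupport.toSchwartzMap (f := fun z => (χ z : ℂ))
      (hχ_supp.comp_left Complex.ofReal_zero) (Complex.ofRealCLM.contDiff.comp hχ_smooth)
  have hX (x) : X x = (χ x : ℂ) := rfl
  have hX0 : X 0 = 1 := by rw [hX, hχ_one 0 (by simp), Complex.ofReal_one]
  obtain ⟨C₀, hC₀, hb⟩ := (𝓕 H).exists_norm_le
  obtain ⟨C₁, hC₁, hl⟩ := (𝓕 H).exists_norm_sub_zero_le
  set A := T * (2 * Real.pi) * C₀ + C₁ with hA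
  set M := ∫ w, ‖w‖ * ‖(𝓕⁻ X) w‖ with hM
  have hA0 : 0 ≤ A := by positivity
  refine ⟨max 1 (A * M / ε), fun R hR t ht m hm => ?_⟩
  have hRpos : 0 < R := one_pos.trans_le ((le_max_left _ _).trans hR)
  set G : EuclideanSpace ℝ (Fin d) → ℂ := fun w => (relSymbol d t m w : ℂ) * (𝓕 H) w with hG
  have hGc : Continuous G :=
    (Complex.continuous_ofReal.comp (continuous_relSymbol d t m)).mul (𝓕 H).continuous
  have hGi : Integrable G :=
    (𝓕 H).integrable.bdd_mul
      (Complex.continuous_ofReal.comp (continuous_relSymbol d t m)).aestronglyMeasurable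
      (c := 1) (Filter.Eventually.of_forall fun w => by
        rw [Complex.norm_real, Real.norm_of_nonneg (by exact (Real.exp_pos _).le)]
        exact relSymbol_le_one ht.1 hm.1 w)
  have hGl (w) : ‖G w - G 0‖ ≤ A * ‖w‖ := by
    have hs := one_sub_relSymbol_le ht.1 hm.1 w
    have hdec : G w - G 0 = ((relSymbol d t m w - 1 : ℝ) : ℂ) * (𝓕 H) w
        + ((𝓕 H) w - (𝓕 H) 0) := by
      simp only [hG, relSymbol_zero hm.1]
      push_cast
      ring
    have hs' : ‖((relSymbol d t m w - 1 : ℝ) : ℂ)‖ ≤ T * (2 * Real.pi) * ‖w‖ := by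
      rw [Complex.norm_real, norm_sub_rev,
        Real.norm_of_nonneg (sub_nonneg.2 (relSymbol_le_one ht.1 hm.1 w))]
      refine hs.trans ?_
      gcongr
      exact ht.2
    rw [hdec]
    calc _ ≤ T * (2 * Real.pi) * ‖w‖ * C₀ + C₁ * ‖w‖ := by
          refine (norm_add_le _ _).trans (add_le_add ?_ (hl w))
          rw [norm_mul]
          gcongr
          exact hb w
      _ = A * ‖w‖ := by rw [hA]; ring
  have hscale : ∫ x : EuclideanSpace ℝ (Fin d),
      ((1 - χ (R⁻¹ • x) : ℝ) : ℂ) * relSemigroup d t m h x =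
      ∫ y, (1 - X y) * 𝓕⁻ (fun w => G (R⁻¹ • w)) y := by
    have hcov := Measure.integral_comp_inv_smul_of_nonneg
      (volume : Measure (EuclideanSpace ℝ (Fin d)))
      (fun y => (1 - X y) * 𝓕⁻ G (R • y)) hRpos.le
    simp only [fourierInv_comp_inv_smul G hRpos, mul_smul_comm, integral_smul]
    rw [← hcov]
    congr 1 with x
    rw [relSemigroup_eq_fourierInv, smul_inv_smul₀ hRpos.ne', hX]
    push_cast
    rfl
  rw [hscale]
  refine (norm_integral_one_sub_mul_fourierInv_le X hX0 (K := A / R)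
    (hGc.comp (continuous_const_smul _)) (hGi.comp_smul (inv_ne_zero hRpos.ne'))
    (by positivity) fun w => ?_).trans ?_
  · simp only [Function.comp_apply, smul_zero]
    refine (hGl _).trans_eq ?_
    rw [norm_smul, norm_inv, Real.norm_of_nonneg hRpos.le]
    ring
  · have := (div_le_iff₀ hε).1 ((le_max_right _ _).trans hR)
    rw [← hM, div_mul_eq_mul_div, div_le_iff₀ hRpos]
    linarith
end
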